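/- Let n ≥ 3 be an integer and assume θ_n ∈ [α_n, γ_n) satisfies F(θ_n) = 0. Then for every θ ∈ [θ_n, β_n), x_+ ∈ (-2, 0) and x_- ∈ (0, 2). -/

import Mathlib

open Real

/-- The left endpoint `α_n` of the interval considered for the `(-2,3,2n+1)`-pretzel knot. -/
noncomputable def alphaN (n : ℕ) : ℝ :=
  if n % 3 = 0 then 2 * π / 3 - π / (6 * (n : ℝ) + 15)
  else if n % 3 = 1 then 2 * π / 3 + π / (6 * (n : ℝ) - 3)
  else 2 * π / 3 - π / (2 * (n : ℝ) + 5)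

/-- The right endpoint `β_n` of the interval considered for the `(-2,3,2n+1)`-pretzel knot. -/
noncomputable def betaN (n : ℕ) : ℝ :=
  if n % 3 = 0 then 2 * π / 3 + π / (6 * (n : ℝ) + 3)
  else if n % 3 = 1 then 2 * π / 3 + π / (2 * (n : ℝ) + 1)
  else 2 * π / 3 - π / (6 * (n : ℝ) + 3)

/-- The interior point `γ_n ∈ (α_n, β_n)`. -/
noncomputable def gammaN (n : ℕ) : ℝ :=
  if n % 3 = 0 then 2 * π / 3
  else if n % 3 = 1 then 2 * π / 3 + 4 * π / (12 * (n : ℝ) + 9)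
  else 2 * π / 3 - 4 * π / (12 * (n : ℝ) + 9)

/-- `F θ = 2 cos ((n+1)θ) cos (3θ/2) - cos ((2n+1)θ/2)`. -/
noncomputable def FN (n : ℕ) (θ : ℝ) : ℝ :=
  2 * Real.cos (((n : ℝ) + 1) * θ) * Real.cos (3 * θ / 2)
    - Real.cos ((2 * (n : ℝ) + 1) * θ / 2)

/-- `r = (S (n-2) y ∓ √(S (n-2) y ^ 2 + 4)) / 2`, with the `-` sign iff `n ≡ 0 (mod 3)`. -/
noncomputable def rD (S : ℤ → ℝ → ℝ) (n : ℕ) (y : ℝ) : ℝ :=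
  if n % 3 = 0 then (S ((n : ℤ) - 2) y - Real.sqrt (S ((n : ℤ) - 2) y ^ 2 + 4)) / 2
  else (S ((n : ℤ) - 2) y + Real.sqrt (S ((n : ℤ) - 2) y ^ 2 + 4)) / 2

/-- `z_ε = ε * √(1 + r (S (n-2) y - S (n-3) y))`, where `ε = ±1` selects `z_±`. -/
noncomputable def zD (S : ℤ → ℝ → ℝ) (n : ℕ) (ε y : ℝ) : ℝ :=
  ε * Real.sqrt (1 + rD S n y * (S ((n : ℤ) - 2) y - S ((n : ℤ) - 3) y))

/-- `x_ε = z_ε * (y + 1 - (S (n-3) y + r)/S (n-2) y)`, where `ε = ±1` selects `x_±`. -/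
noncomputable def xD (S : ℤ → ℝ → ℝ) (n : ℕ) (ε y : ℝ) : ℝ :=
  zD S n ε y * (y + 1 - (S ((n : ℤ) - 3) y + rD S n y) / S ((n : ℤ) - 2) y)

/-- A sequence satisfying the Chebyshev recurrence satisfies `S k (2 cos θ) sin θ = sin ((k+1)θ)`. -/
theorem chebyshev_mul_sin (S : ℤ → ℝ → ℝ)
    (hS0 : ∀ y : ℝ, S 0 y = 1) (hS1 : ∀ y : ℝ, S 1 y = y)
    (hSrec : ∀ (k : ℤ) (y : ℝ), S k y = y * S (k - 1) y - S (k - 2) y) (θ : ℝ) (k : ℕ) :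
    S k (2 * cos θ) * sin θ = sin ((k + 1) * θ) := by
  induction k using Nat.twoStepInduction with
  | zero => simp [hS0]
  | one =>
    have h : ((1 : ℕ) + 1 : ℝ) * θ = 2 * θ := by push_cast; ring
    rw [h, sin_two_mul, Nat.cast_one, hS1]
    ring
  | more k ih₀ ih₁ =>
    have h₁ : ((k + 2 : ℕ) : ℤ) - 1 = (k + 1 : ℕ) := by push_cast; ring
    have h₀ : ((k + 2 : ℕ) : ℤ) - 2 = k := by push_cast; ring
    rw [hSrec, h₁, h₀, sub_mul, mul_assoc, ih₀, ih₁]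
    have e₂ : ((k + 2 : ℕ) + 1 : ℝ) * θ = ((k + 1 : ℕ) + 1) * θ + θ := by push_cast; ring
    have e₀ : ((k : ℝ) + 1) * θ = ((k + 1 : ℕ) + 1) * θ - θ := by push_cast; ring
    rw [e₂, e₀, sin_add, sin_sub]
    ring

/-- The algebraic core: `a, b` play the roles of consecutive Chebyshev values `S (n-2), S (n-3)`,
and `r` is the positive root of `r² = a r + 1`. -/
theorem sqrt_mul_mem_Ioo {a b c y r : ℝ} (hc : c = y * a - b)
    (hab : a ^ 2 + b ^ 2 - y * a * b = 1) (hr : r ^ 2 = a * r + 1) (hr0 : 0 < r)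
    (ha : 0 < a) (hb : b ≤ 0) (hbr : 0 ≤ a - (1 + y) * b)
    (hc₁ : 0 < a - (1 + y) * c) (hc₂ : 0 < a + (1 - y) * c) :
    √(1 + r * (a - b)) * (y + 1 - (b + r) / a) ∈ Set.Ioo (-2 : ℝ) 0 := by
  have hbc : b * c = a ^ 2 - 1 := by rw [hc]; linear_combination -hab
  have hacy : a ^ 2 + c ^ 2 - y * a * c = 1 := by rw [hc]; linear_combination hab
  have hrb : 0 ≤ r + b := by
    have h : 0 ≤ (r + b) * (1 - b * r) := by
      have e : (r + b) * (1 - b * r) = r * (a * (a - (1 + y) * b)) := by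
        linear_combination (-b) * hr - r * hab
      rw [e]; positivity
    exact nonneg_of_mul_nonneg_left h (by nlinarith)
  have h₁ : 0 < (1 - r * c) * (r + c) := by
    have e : (1 - r * c) * (r + c) = r * (a * (a - (1 + y) * c)) := by
      linear_combination (-c) * hr - r * hacy
    rw [e]; positivity
  have h₂ : 0 < (1 + r * c) * (r - c) := by
    have e : (1 + r * c) * (r - c) = r * (a * (a + (1 - y) * c)) := by
      linear_combination c * hr - r * hacy
    rw [e]; positivity
  have hrc : r * c < 1 ∧ -1 < r * c := by
    rcases le_total 0 c with h | h
    · have := pos_of_mul_pos_left h₁ (by linarith)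
      constructor <;> nlinarith
    · have := pos_of_mul_pos_left h₂ (by linarith)
      constructor <;> nlinarith
  obtain ⟨hv₁, hv₂⟩ := hrc
  have hP : 1 + r * (a - b) = r * (r - b) := by linear_combination -hr
  have hP0 : 0 < r * (r - b) := mul_pos hr0 (by linarith)
  have hw : y + 1 - (b + r) / a = -((1 - r * c) / (r * a)) := by
    rw [hc]
    field_simp
    linear_combination -hr
  have hra : 0 < r * a := mul_pos hr0 ha
  have hq : 0 < (1 - r * c) / (r * a) := div_pos (by linarith) hra
  rw [hP, hw]
  have hs : 0 < √(r * (r - b)) := sqrt_pos.2 hP0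
  refine ⟨?_, by nlinarith [mul_pos hs hq]⟩
  have hlt : √(r * (r - b)) * ((1 - r * c) / (r * a)) < 2 := by
    rw [← mul_div_assoc, div_lt_iff₀ hra]
    refine lt_of_pow_lt_pow_left₀ 2 (by positivity) ?_
    rw [mul_pow, sq_sqrt hP0.le]
    have e : (2 * (r * a)) ^ 2 - r * (r - b) * (1 - r * c) ^ 2 =
        r * ((r + b) * (1 + r * c) ^ 2 + (1 - r * c) * (2 + 2 * (r * c)) * r) := by
      linear_combination (-4 * r ^ 2) * hbc
    have h₃ : 0 < (1 - r * c) * (2 + 2 * (r * c)) * r :=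
      mul_pos (mul_pos (by linarith) (by linarith)) hr0
    have h₄ : 0 < r * ((r + b) * (1 + r * c) ^ 2 + (1 - r * c) * (2 + 2 * (r * c)) * r) := by
      positivity
    linarith
  linarith

/-- The trigonometric form of `sqrt_mul_mem_Ioo`, for an angle `p` representing `(n-2)θ`
modulo `π`. -/
theorem sqrt_mul_mem_Ioo_of_angle {a b r p θ : ℝ}
    (ha : a * sin θ = sin (p + θ)) (hb : b * sin θ = sin p)
    (hr : r ^ 2 = a * r + 1) (hr0 : 0 < r) (hθ : θ ∈ Set.Ioo (π / 2) π)
    (hp : p ≤ 0) (hpθ : 0 < p + θ) (hp' : -π ≤ p - θ / 2)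
    (hpl : π < p + 5 * θ / 2) (hpu : p + 5 * θ / 2 < 3 * π / 2) :
    √(1 + r * (a - b)) * (2 * cos θ + 1 - (b + r) / a) ∈ Set.Ioo (-2 : ℝ) 0 := by
  obtain ⟨hθ₁, hθ₂⟩ := hθ
  have hpi := pi_pos
  have hsin : 0 < sin θ := sin_pos_of_pos_of_lt_pi (by linarith) hθ₂
  have hsinh : 0 < sin (θ / 2) := sin_pos_of_pos_of_lt_pi (by linarith) (by linarith)
  have hcosh : 0 < cos (θ / 2) := cos_pos_of_mem_Ioo ⟨by linarith, by linarith⟩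
  have hc : (2 * cos θ * a - b) * sin θ = sin (p + θ + θ) := by
    have e : p = p + θ - θ := by ring
    rw [e, sin_sub] at hb
    rw [sin_add (p + θ)]
    linear_combination 2 * cos θ * ha - hb
  have half : ∀ u v : ℝ, sin (u + v) + sin (u - v) = 2 * sin u * cos v := fun u v ↦ by
    rw [sin_add, sin_sub]; ring
  have half' : ∀ u v : ℝ, sin (u + v) - sin (u - v) = 2 * cos u * sin v := fun u v ↦ by
    rw [sin_add, sin_sub]; ring
  refine sqrt_mul_mem_Ioo (c := 2 * cos θ * a - b) rfl ?_ hr hr0 ?_ ?_ ?_ ?_ ?_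
  · have hs2 := sin_sq_add_cos_sq θ
    have hp2 := sin_sq_add_cos_sq p
    rw [sin_add, ← hb] at ha
    have hcp : cos p = a - b * cos θ := by
      refine mul_right_cancel₀ hsin.ne' ?_
      linear_combination -ha
    rw [hcp, ← hb] at hp2
    linear_combination hp2 - b ^ 2 * hs2
  · refine pos_of_mul_pos_left ?_ hsin.le
    rw [ha]
    exact sin_pos_of_pos_of_lt_pi hpθ (by linarith)
  · refine nonpos_of_mul_nonpos_left ?_ hsin
    rw [hb]
    exact sin_nonpos_of_nonpos_of_neg_pi_le hp (by linarith)
  · refine nonneg_of_mul_nonneg_left ?_ hsin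
    have e : (a - (1 + 2 * cos θ) * b) * sin θ = 2 * -sin (p - θ / 2) * cos (θ / 2) := by
      have h := half (p - θ / 2) (θ / 2)
      rw [show p - θ / 2 + θ / 2 = p by ring, show p - θ / 2 - θ / 2 = p - θ by ring, sin_sub] at h
      rw [sin_add] at ha
      linear_combination ha - h - (1 + 2 * cos θ) * hb
    rw [e]
    have := sin_nonpos_of_nonpos_of_neg_pi_le (x := p - θ / 2) (by linarith) hp'
    exact mul_nonneg (by linarith) hcosh.le
  · refine pos_of_mul_pos_left ?_ hsin.le
    have e : (a - (1 + 2 * cos θ) * (2 * cos θ * a - b)) * sin θ =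
        2 * sin (p + 5 * θ / 2 - π) * cos (θ / 2) := by
      have h := half (p + 5 * θ / 2) (θ / 2)
      rw [show p + 5 * θ / 2 + θ / 2 = p + θ + θ + θ by ring,
        show p + 5 * θ / 2 - θ / 2 = p + θ + θ by ring, sin_add (p + θ + θ)] at h
      have h' : sin (p + θ) = sin (p + θ + θ - θ) := by ring_nf
      rw [h', sin_sub] at ha
      rw [sin_sub_pi]
      linear_combination ha - h - (1 + 2 * cos θ) * hc
    rw [e]
    have := sin_pos_of_pos_of_lt_pi (x := p + 5 * θ / 2 - π) (by linarith) (by linarith)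
    positivity
  · refine pos_of_mul_pos_left ?_ hsin.le
    have e : (a + (1 - 2 * cos θ) * (2 * cos θ * a - b)) * sin θ =
        2 * cos (p + 5 * θ / 2 - π) * sin (θ / 2) := by
      have h := half' (p + 5 * θ / 2) (θ / 2)
      rw [show p + 5 * θ / 2 + θ / 2 = p + θ + θ + θ by ring,
        show p + 5 * θ / 2 - θ / 2 = p + θ + θ by ring, sin_add (p + θ + θ)] at h
      have h' : sin (p + θ) = sin (p + θ + θ - θ) := by ring_nf
      rw [h', sin_sub] at ha
      rw [cos_sub_pi]
      linear_combination ha - h + (1 - 2 * cos θ) * hc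
    rw [e]
    have := cos_pos_of_mem_Ioo (x := p + 5 * θ / 2 - π) ⟨by linarith, by linarith⟩
    positivity

theorem sq_half_add_sqrt (a : ℝ) :
    ((a + √(a ^ 2 + 4)) / 2) ^ 2 = a * ((a + √(a ^ 2 + 4)) / 2) + 1 := by
  have := sq_sqrt (show 0 ≤ a ^ 2 + 4 by positivity)
  linear_combination this / 4

theorem half_add_sqrt_pos (a : ℝ) : 0 < (a + √(a ^ 2 + 4)) / 2 := by
  have : |a| < √(a ^ 2 + 4) := by
    rw [← sqrt_sq_eq_abs]
    exact sqrt_lt_sqrt (sq_nonneg a) (by linarith)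
  linarith [neg_abs_le a]

/-- Let `S k` be the Chebyshev polynomials of the second kind
(`S 0 y = 1`, `S 1 y = y`, `S k y = y * S (k-1) y - S (k-2) y` for all integers `k`).
Let `n ≥ 3` and `θ_n ∈ [α_n, γ_n)` with `F(θ_n) = 0`. Then for every `θ ∈ [θ_n, β_n)`,
with `y = 2 cos θ`, one has `x_+ ∈ (-2, 0)` and `x_- ∈ (0, 2)`. -/
theorem x_range
    (S : ℤ → ℝ → ℝ)
    (hS0 : ∀ y : ℝ, S 0 y = 1)
    (hS1 : ∀ y : ℝ, S 1 y = y)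
    (hSrec : ∀ (k : ℤ) (y : ℝ), S k y = y * S (k - 1) y - S (k - 2) y)
    (n : ℕ) (hn : 3 ≤ n)
    (θn : ℝ) (hθn : θn ∈ Set.Ico (alphaN n) (gammaN n)) (hFθn : FN n θn = 0) :
    ∀ θ ∈ Set.Ico θn (betaN n),
      xD S n 1 (2 * Real.cos θ) ∈ Set.Ioo (-2 : ℝ) 0 ∧
      xD S n (-1) (2 * Real.cos θ) ∈ Set.Ioo (0 : ℝ) 2 := by
  rintro θ ⟨hθ₁, hθ₂⟩
  replace hθ₁ : alphaN n ≤ θ := hθn.1.trans hθ₁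
  suffices h : xD S n 1 (2 * cos θ) ∈ Set.Ioo (-2 : ℝ) 0 by
    have e : xD S n (-1) (2 * cos θ) = -xD S n 1 (2 * cos θ) := by
      simp only [xD, zD]; ring
    rw [e]
    exact ⟨h, by linarith [h.2], by linarith [h.1]⟩
  have hpi := pi_pos
  have hn' : (3 : ℝ) ≤ n := by exact_mod_cast hn
  have ha : S ((n : ℤ) - 2) (2 * cos θ) * sin θ = sin ((n - 2) * θ + θ) := by
    have h := chebyshev_mul_sin S hS0 hS1 hSrec θ (n - 2)
    rw [Nat.cast_sub (by lia), Nat.cast_sub (by lia)] at h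
    push_cast at h
    rw [h]; ring_nf
  have hb : S ((n : ℤ) - 3) (2 * cos θ) * sin θ = sin ((n - 2) * θ) := by
    have h := chebyshev_mul_sin S hS0 hS1 hSrec θ (n - 3)
    rw [Nat.cast_sub hn, Nat.cast_sub hn] at h
    push_cast at h
    rw [h]; ring_nf
  simp only [xD, zD, rD, one_mul]
  generalize S ((n : ℤ) - 2) (2 * cos θ) = a at *
  generalize S ((n : ℤ) - 3) (2 * cos θ) = b at *
  obtain ⟨δ, rfl⟩ : ∃ δ, θ = 2 * π / 3 + δ := ⟨θ - 2 * π / 3, by ring⟩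
  have hnm := Nat.div_add_mod n 3
  generalize hm : n / 3 = m at hnm
  have hmod : n % 3 = 0 ∨ n % 3 = 1 ∨ n % 3 = 2 := by lia
  rcases hmod with h | h | h <;> rw [h] at hnm <;>
    simp only [alphaN, betaN, h, if_true, one_ne_zero, OfNat.ofNat_ne_zero, OfNat.ofNat_ne_one,
      if_false] at hθ₁ hθ₂ ⊢
  · have hnm' : n * π = 3 * (m * π) := by rw [← hnm]; push_cast; ring
    have h₁ : -δ * (6 * n + 15) ≤ π := (le_div_iff₀ (by linarith)).1 (by linarith)
    have h₂ : δ * (6 * n + 3) < π := (lt_div_iff₀ (by linarith)).1 (by linarith)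
    have hδ₁ : -(π / 33) ≤ δ := by
      by_contra! hlt
      nlinarith
    have hδ₂ : δ ≤ π / 21 := by
      by_contra! hlt
      nlinarith
    have hδ₃ : 3 * δ ≤ n * δ + π / 6 := by
      rcases le_total 0 δ with hδ | hδ
      · nlinarith
      · linarith
    have key := sqrt_mul_mem_Ioo_of_angle (a := -a) (b := -b)
      (p := (n - 2) * (2 * π / 3 + δ) + π - m * (2 * π)) (θ := 2 * π / 3 + δ)
      (by
        rw [show (n - 2) * (2 * π / 3 + δ) + π - m * (2 * π) + (2 * π / 3 + δ) =
          (n - 2) * (2 * π / 3 + δ) + (2 * π / 3 + δ) + π - m * (2 * π) by ring,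
          sin_sub_nat_mul_two_pi, sin_add_pi, ← ha, neg_mul])
      (by rw [sin_sub_nat_mul_two_pi, sin_add_pi, ← hb, neg_mul])
      (sq_half_add_sqrt (-a)) (half_add_sqrt_pos (-a)) ⟨by linarith, by linarith⟩
      (by linarith) (by linarith) (by linarith) (by linarith) (by linarith)
    rw [neg_sq] at key
    convert key using 2
    · congr 1; ring
    · rw [← neg_div_neg_eq]; ring
  · have hnm' : n * π = 3 * (m * π) + π := by rw [← hnm]; push_cast; ring
    have h₁ : π ≤ δ * (6 * n - 3) := (div_le_iff₀ (by linarith)).1 (by linarith)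
    have h₂ : δ * (2 * n + 1) < π := (lt_div_iff₀ (by linarith)).1 (by linarith)
    have hδ₁ : 0 < δ := pos_of_mul_pos_left (hpi.trans_le h₁) (by linarith)
    have hδ₂ : 3 * δ ≤ n * δ := by gcongr
    refine sqrt_mul_mem_Ioo_of_angle
      (p := (n - 2) * (2 * π / 3 + δ) - m * (2 * π)) ?_ ?_
      (sq_half_add_sqrt a) (half_add_sqrt_pos a) ⟨by linarith, by linarith⟩
      (by linarith) (by linarith) (by linarith) (by linarith) (by linarith)
    · rw [ha, sub_add_eq_add_sub, sin_sub_nat_mul_two_pi]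
    · rw [hb, sin_sub_nat_mul_two_pi]
  · have hnm' : n * π = 3 * (m * π) + 2 * π := by rw [← hnm]; push_cast; ring
    have h₁ : -δ * (2 * n + 5) ≤ π := (le_div_iff₀ (by linarith)).1 (by linarith)
    have h₂ : π < -δ * (6 * n + 3) := (div_lt_iff₀ (by linarith)).1 (by linarith)
    have hδ₁ : 0 < -δ := pos_of_mul_pos_left (hpi.trans h₂) (by linarith)
    have hδ₂ : 3 * -δ ≤ n * -δ := by gcongr
    refine sqrt_mul_mem_Ioo_of_angle
      (p := (n - 2) * (2 * π / 3 + δ) - m * (2 * π)) ?_ ?_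
      (sq_half_add_sqrt a) (half_add_sqrt_pos a) ⟨by linarith, by linarith⟩
      (by linarith) (by linarith) (by linarith) (by linarith) (by linarith)
    · rw [ha, sub_add_eq_add_sub, sin_sub_nat_mul_two_pi]
    · rw [hb, sin_sub_nat_mul_two_pi]
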